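/- For a, b, c, d ∈ ℝ define the operator τ^{(a,b,c,d)*} = μ₁L + μ₂M₁ + μ₃M₂ + μ₄R₁ + μ₅R₂ with μ₁ = ½(1−(a+b+c+d)) + (ab+cd), μ₂ = ½(a+b−c−d) − (ab−cd), μ₃ = ½(c+d−a−b), μ₄ = −¼, μ₅ = ½(a+b+c+d) − ¾, where L, M₁, M₂, R₁, R₂ are the S-Heun operators on the discrete linear grid. Then for all a, b, c, d, e ∈ ℝ the following two Rains-type quasi-commutation identities hold as operator identities (acting on all functions f : ℝ → ℝ): (1) τ^{(a+e,b,c,d−e)*} ∘ τ^{(a−½,b+½,c+½,d−½)*} = τ^{(a,b,c,d)*} ∘ τ^{(a−½+e,b+½,c+½,d−½−e)*}, and (2) τ^{(a,b+e,c−e,d)*} ∘ τ^{(a+½,b−½,c−½,d+½)*} = τ^{(a,b,c,d)*} ∘ τ^{(a+½,b−½+e,c−½−e,d+½)*}. -/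

import Mathlib

/-- Lowering S-Heun operator `L = ½(T₊ − T₋)` on the discrete linear grid. -/
noncomputable def opL (f : ℝ → ℝ) : ℝ → ℝ := fun x => (f (x+1) - f (x-1)) / 2
/-- Stabilizing S-Heun operator `M₁ = ½(T₊ + T₋)`. -/
noncomputable def opM1 (f : ℝ → ℝ) : ℝ → ℝ := fun x => (f (x+1) + f (x-1)) / 2
/-- Stabilizing S-Heun operator `M₂ = ½ x (T₊ − T₋)`. -/
noncomputable def opM2 (f : ℝ → ℝ) : ℝ → ℝ := fun x => x * (f (x+1) - f (x-1)) / 2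
/-- Raising S-Heun operator `R₁ = ½ x [(1−2x)T₊ + (1+2x)T₋]`. -/
noncomputable def opR1 (f : ℝ → ℝ) : ℝ → ℝ :=
  fun x => x * ((1 - 2*x) * f (x+1) + (1 + 2*x) * f (x-1)) / 2
/-- Raising S-Heun operator `R₂ = ½ x (T₊ + T₋)`. -/
noncomputable def opR2 (f : ℝ → ℝ) : ℝ → ℝ := fun x => x * (f (x+1) + f (x-1)) / 2

/-- The backward operator `τ^{(a,b,c,d)*} = μ₁L + μ₂M₁ + μ₃M₂ + μ₄R₁ + μ₅R₂`. -/
noncomputable def tauS (a b c d : ℝ) (f : ℝ → ℝ) : ℝ → ℝ := fun x =>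
  ((1/2)*(1-(a+b+c+d)) + (a*b+c*d)) * opL f x
  + ((1/2)*(a+b-c-d) - (a*b-c*d)) * opM1 f x
  + ((1/2)*(c+d-a-b)) * opM2 f x
  + (-(1/4)) * opR1 f x
  + ((1/2)*(a+b+c+d) - 3/4) * opR2 f x

theorem tauS_eq (a b c d : ℝ) (f : ℝ → ℝ) (x : ℝ) : tauS a b c d f x =
    (x+2*c-1)*(x+2*d-1)/4 * f (x+1) - (x-2*a+1)*(x-2*b+1)/4 * f (x-1) := by
  simp only [tauS, opL, opM1, opM2, opR1, opR2]
  ring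

/-- The two Rains-type quasi-commutation identities for `τ^{(a,b,c,d)*}`. -/
theorem stmt_8 (a b c d e : ℝ) :
    (∀ (f : ℝ → ℝ) (x : ℝ),
      tauS (a+e) b c (d-e) (tauS (a-1/2) (b+1/2) (c+1/2) (d-1/2) f) x
        = tauS a b c d (tauS (a-1/2+e) (b+1/2) (c+1/2) (d-1/2-e) f) x) ∧
    (∀ (f : ℝ → ℝ) (x : ℝ),
      tauS a (b+e) (c-e) d (tauS (a+1/2) (b-1/2) (c-1/2) (d+1/2) f) x
        = tauS a b c d (tauS (a+1/2) (b-1/2+e) (c-1/2-e) (d+1/2) f) x) := by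
  constructor
  all_goals
    intro f x
    simp only [tauS_eq, add_sub_cancel_right, sub_add_cancel]
    generalize f (x+1+1) = p
    generalize f (x-1-1) = q
    generalize f x = r
    ring
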